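/- arXiv:0810.4752 — 2 statements merged into one kernel-verified Lean document; each statement's English description precedes it below -/
import Mathlib

section
/- (No free lunch theorem; arbitrarily close to random guessing.) Let 𝒳 be an infinite set equipped with the σ-algebra of all its subsets (e.g. 𝒳 = ℕ) and 𝒴 = {−1, +1}. Fix ε > 0 and n ∈ ℕ. For every classification rule, i.e. every measurable map g_n that assigns to each possible sample ((x_1, y_1), …, (x_n, y_n)) ∈ (𝒳 × 𝒴)^n a classifier g_n(·) : 𝒳 → 𝒴, there exists a probability distribution P on 𝒳 × 𝒴 whose Bayes risk is 0 such that the expected risk of the learned classifier f_n = g_n((X_1, Y_1), …, (X_n, Y_n)) satisfies E[R(f_n)] > 1/2 − ε, where the sample (X_1, Y_1), …, (X_n, Y_n) is drawn i.i.d. from P. -/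
open MeasureTheory

/-- The risk of a classifier under the 0-1 loss. Labels `{−1,+1}` are encoded as `Bool`. -/
noncomputable def risk {X : Type*} [MeasurableSpace X] (P : Measure (X × Bool))
    (f : X → Bool) : ℝ :=
  (P {p | f p.1 ≠ p.2}).toReal

open ProbabilityTheory in
theorem uniformOn_univ_toReal_setOf {ι : Type*} [Fintype ι] [MeasurableSpace ι]
    [MeasurableSingletonClass ι] (p : ι → Prop) [DecidablePred p] :
    (uniformOn (Set.univ : Set ι) {i | p i}).toReal
      = (∑ i, if p i then (1 : ℝ) else 0) / Fintype.card ι := by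
  rw [uniformOn_univ, ENNReal.toReal_div, ENNReal.toReal_natCast,
    Measure.count_apply_finite _ (Set.toFinite _), ENNReal.toReal_natCast]
  simp [Finset.sum_boole]

/-- A prediction of the label at `i` that does not depend on that label is wrong for exactly half
of all labelings. -/
theorem sum_ite_ne_eq_half_card {ι : Type*} [Fintype ι] [DecidableEq ι] (i : ι)
    (a : (ι → Bool) → Bool) (ha : ∀ σ b, a (Function.update σ i b) = a σ) :
    ∑ σ : ι → Bool, (if a σ ≠ σ i then (1 : ℝ) else 0) = Fintype.card (ι → Bool) / 2 := by
  have hflip : Function.Involutive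
      fun σ : ι → Bool => Function.update σ i (!σ i) := fun σ => by simp
  have h1 : ∑ σ : ι → Bool, (if a σ ≠ σ i then (1 : ℝ) else 0)
      = ∑ σ : ι → Bool, (if a σ = σ i then (1 : ℝ) else 0) := by
    refine Fintype.sum_equiv hflip.toPerm _ _ fun σ => ?_
    simp only [Function.Involutive.coe_toPerm, ha, Function.update_self]
    cases a σ <;> cases σ i <;> simp
  have h2 : ∑ σ : ι → Bool, (if a σ ≠ σ i then (1 : ℝ) else 0)
      + ∑ σ : ι → Bool, (if a σ = σ i then (1 : ℝ) else 0) = Fintype.card (ι → Bool) := by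
    rw [← Finset.sum_add_distrib, Finset.sum_congr rfl (g := fun _ => (1 : ℝ))]
    · simp
    · intro σ _
      by_cases h : a σ = σ i <;> simp [h]
  linarith

/-- For a fixed list `t` of sampled indices, the number of errors summed over all labelings is
large, because unseen indices are mislabeled half of the time. -/
theorem le_sum_sum_ite_ne {n N : ℕ} (t : Fin n → Fin N)
    (a : (Fin N → Bool) → Fin N → Bool)
    (ha : ∀ σ τ, (∀ j, σ (t j) = τ (t j)) → a σ = a τ) :
    ((N : ℝ) - n) * (Fintype.card (Fin N → Bool) / 2)
      ≤ ∑ σ : Fin N → Bool, ∑ i, (if a σ i ≠ σ i then (1 : ℝ) else 0) := by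
  classical
  rw [Finset.sum_comm]
  have hcard : (N : ℝ) - n ≤ ((Finset.univ.image t)ᶜ.card : ℝ) := by
    have h1 := Finset.card_add_card_compl (Finset.univ.image t)
    have h2 : (Finset.univ.image t).card ≤ n := by
      simpa using Finset.card_image_le (s := Finset.univ) (f := t)
    rw [Fintype.card_fin] at h1
    have h3 : N ≤ (Finset.univ.image t)ᶜ.card + n := by omega
    have h4 : (N : ℝ) ≤ ((Finset.univ.image t)ᶜ.card : ℝ) + n := by exact_mod_cast h3
    linarith
  calc ((N : ℝ) - n) * (Fintype.card (Fin N → Bool) / 2)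
      ≤ ((Finset.univ.image t)ᶜ.card : ℝ) * (Fintype.card (Fin N → Bool) / 2) := by
        gcongr
    _ = ∑ i ∈ (Finset.univ.image t)ᶜ, ∑ σ : Fin N → Bool,
          (if a σ i ≠ σ i then (1 : ℝ) else 0) := by
        rw [← nsmul_eq_mul, ← Finset.sum_const]
        refine Finset.sum_congr rfl fun i hi => ?_
        refine (sum_ite_ne_eq_half_card i (fun σ => a σ i) fun σ b => ?_).symm
        refine congrFun (ha _ _ fun j => Function.update_of_ne ?_ _ _) i
        rintro rfl
        simp at hi
    _ ≤ _ := by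
        refine Finset.sum_le_sum_of_subset_of_nonneg (Finset.subset_univ _) fun i _ _ => ?_
        exact Finset.sum_nonneg fun σ _ => by split_ifs <;> norm_num

/-- The uniform distribution on the labeled points `(e i, σ i)`. -/
noncomputable def labeledUniform {X : Type*} [MeasurableSpace X] {N : ℕ} (e : Fin N → X)
    (σ : Fin N → Bool) : Measure (X × Bool) :=
  (ProbabilityTheory.uniformOn (Set.univ : Set (Fin N))).map fun i => (e i, σ i)

theorem risk_labeledUniform {X : Type*} [MeasurableSpace X] {N : ℕ} (e : Fin N → X)
    (σ : Fin N → Bool) {f : X → Bool} (hf : Measurable f) :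
    risk (labeledUniform e σ) f = (∑ i, if f (e i) ≠ σ i then (1 : ℝ) else 0) / N := by
  have hs : MeasurableSet {p : X × Bool | f p.1 ≠ p.2} :=
    (measurableSet_eq_fun (hf.comp measurable_fst) measurable_snd).compl
  rw [risk, labeledUniform, Measure.map_apply (measurable_of_finite _) hs, Set.preimage_ofPred_eq,
    uniformOn_univ_toReal_setOf, Fintype.card_fin]

theorem integral_risk_labeledUniform {X : Type*} [MeasurableSpace X] {N n : ℕ} [NeZero N]
    (e : Fin N → X) (σ : Fin N → Bool) (g : (Fin n → X × Bool) → X → Bool)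
    (hg : Measurable fun p : (Fin n → X × Bool) × X => g p.1 p.2) :
    ∫ s, risk (labeledUniform e σ) (g s) ∂(Measure.pi fun _ : Fin n => labeledUniform e σ)
      = ∫ t : Fin n → Fin N,
          (∑ i, if g (fun j => (e (t j), σ (t j))) (e i) ≠ σ i then (1 : ℝ) else 0) / N
        ∂(Measure.pi fun _ => ProbabilityTheory.uniformOn Set.univ) := by
  have hgs (s) : Measurable (g s) := hg.comp measurable_prodMk_left
  have hgx (x) : Measurable fun s => g s x := hg.comp measurable_prodMk_right
  have hm : Measurable fun i : Fin N => (e i, σ i) := measurable_of_finite _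
  have : IsProbabilityMeasure (labeledUniform e σ) :=
    Measure.isProbabilityMeasure_map hm.aemeasurable
  simp_rw [risk_labeledUniform e σ (hgs _)]
  have hpi : (Measure.pi fun _ : Fin n => labeledUniform e σ)
      = (Measure.pi fun _ : Fin n => ProbabilityTheory.uniformOn (Set.univ : Set (Fin N))).map
          fun t j => (e (t j), σ (t j)) :=
    (Measure.pi_map_pi (fun _ => hm.aemeasurable)).symm
  rw [hpi, integral_map (measurable_of_finite _).aemeasurable]
  refine (Measurable.div_const (Finset.measurable_sum _ fun i _ => ?_) _).aestronglyMeasurable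
  exact Measurable.ite (measurableSet_eq_fun (hgx (e i)) measurable_const).compl
    measurable_const measurable_const

/-- **No free lunch theorem (arbitrarily close to random guessing).** Let `𝒳` be an infinite
set with the σ-algebra of all subsets. Fix `ε > 0` and `n`. For every (measurable)
classification rule `g` mapping an `n`-sample to a classifier, there is a probability
distribution `P` on `𝒳 × {−1,+1}` with Bayes risk `0` such that the expected risk of the
learned classifier exceeds `1/2 − ε`. -/
theorem no_free_lunch {X : Type*} [Infinite X] [mX : MeasurableSpace X] (hmX : mX = ⊤)
    (ε : ℝ) (hε : 0 < ε) (n : ℕ)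
    (g : (Fin n → X × Bool) → X → Bool)
    (hg : Measurable fun p : (Fin n → X × Bool) × X => g p.1 p.2) :
    ∃ P : Measure (X × Bool), IsProbabilityMeasure P ∧
      (∃ f : X → Bool, Measurable f ∧ risk P f = 0) ∧
      1 / 2 - ε < ∫ s, risk P (g s) ∂(Measure.pi fun _ : Fin n => P) := by
  have : DiscreteMeasurableSpace X := ⟨fun s => by rw [hmX]; trivial⟩
  obtain ⟨N, hN⟩ := exists_nat_gt (n / (2 * ε))
  have hN0 : (0 : ℝ) < N := lt_of_le_of_lt (by positivity) hN
  have : NeZero N := ⟨by rintro rfl; simp at hN0⟩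
  rw [div_lt_iff₀ (by positivity)] at hN
  let e : Fin N ↪ X := Fin.valEmbedding.trans (Infinite.natEmbedding X)
  suffices h : ∃ σ : Fin N → Bool, 1 / 2 - ε < ∫ s, risk (labeledUniform e σ) (g s)
      ∂(Measure.pi fun _ : Fin n => labeledUniform e σ) by
    obtain ⟨σ, hσ⟩ := h
    have hf : Measurable fun x => σ (Function.invFun e x) := Measurable.of_discrete
    refine ⟨labeledUniform e σ,
      Measure.isProbabilityMeasure_map (measurable_of_finite _).aemeasurable,
      ⟨_, hf, ?_⟩, hσ⟩
    rw [risk_labeledUniform _ _ hf]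
    simp [Function.leftInverse_invFun e.injective _]
  by_contra! hle
  simp_rw [integral_risk_labeledUniform e _ g hg] at hle
  have hupper := Finset.sum_le_sum fun σ (_ : σ ∈ Finset.univ) => hle σ
  rw [← integral_finsetSum _ fun σ _ => Integrable.of_finite, Finset.sum_const, Finset.card_univ,
    nsmul_eq_mul] at hupper
  set K : ℝ := (Fintype.card (Fin N → Bool) : ℝ)
  have hK : 0 < K := by simp only [K]; exact_mod_cast Fintype.card_pos
  have hlower : ((N : ℝ) - n) * (K / 2) / N ≤ ∫ t : Fin n → Fin N, ∑ σ : Fin N → Bool,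
      (∑ i, if g (fun j => (e (t j), σ (t j))) (e i) ≠ σ i then (1 : ℝ) else 0) / N
      ∂(Measure.pi fun _ => ProbabilityTheory.uniformOn Set.univ) := by
    calc ((N : ℝ) - n) * (K / 2) / N
        = ∫ _ : Fin n → Fin N, ((N : ℝ) - n) * (K / 2) / N
            ∂(Measure.pi fun _ => ProbabilityTheory.uniformOn Set.univ) := by simp
      _ ≤ _ := by
        refine integral_mono Integrable.of_finite Integrable.of_finite fun t => ?_
        simp only [← Finset.sum_div]
        gcongr
        refine le_sum_sum_ite_ne t (fun σ i => g (fun j => (e (t j), σ (t j))) (e i))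
          fun σ τ h => ?_
        simp only [h]
  have h := hlower.trans hupper
  rw [div_le_iff₀ hN0] at h
  nlinarith
end

section
/- (Bayes consistency via nested function spaces.) Let F_1 ⊆ F_2 ⊆ F_3 ⊆ … be an increasing sequence of countable classes of classifiers, and for each n let f_n be an empirical risk minimizer over F_n on the i.i.d. n-sample: f_n ∈ F_n with R_emp(f_n) ≤ R_emp(f) for all f ∈ F_n. Assume: (1) each F_n has finite VC dimension and VC(F_n)·log(n)/n → 0 as n → ∞; and (2) for the distribution P under consideration, inf_{f ∈ F_n} R(f) → R* as n → ∞, where R* is the Bayes risk of P. If (1) holds and (2) holds for every distribution P, then the sequence of classifiers (f_n) is universally Bayes-consistent: for every distribution P and every ε > 0, Pr(R(f_n) − R* > ε) → 0 as n → ∞. -/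
open MeasureTheory Filter

/-- The empirical risk of a classifier on a sample of `n` labeled points. -/
noncomputable def empRisk {X : Type*} {n : ℕ} (f : X → Bool) (s : Fin n → X × Bool) : ℝ :=
  ((Finset.univ.filter fun i => f (s i).1 ≠ (s i).2).card : ℝ) / n

/-- The Bayes risk: the infimum of the risk over all measurable classifiers. -/
noncomputable def bayesRisk {X : Type*} [MeasurableSpace X] (P : Measure (X × Bool)) : ℝ :=
  ⨅ f : {f : X → Bool // Measurable f}, risk P (f : X → Bool)

/-- A class `F` shatters some set of `m` points: all `2^m` labelings of these points are
realized by functions in `F`. -/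
def ShattersCard {X : Type*} (F : Set (X → Bool)) (m : ℕ) : Prop :=
  ∃ x : Fin m → X, ∀ v : Fin m → Bool, ∃ f ∈ F, ∀ i, f (x i) = v i

open scoped ENNReal

/-- The real sign attached to a Boolean. -/
def boolSign (b : Bool) : ℝ := if b then 1 else -1

theorem sum_exp_sign_sum_le {n : ℕ} (a : Fin n → ℝ) (ha : ∀ i, |a i| ≤ 1) (t : ℝ) :
    ∑ σ : Fin n → Bool, Real.exp (t * ∑ i, boolSign (σ i) * a i) ≤
      2 ^ n * Real.exp (n * (t ^ 2 / 2)) := by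
  have hprod : ∑ σ : Fin n → Bool, Real.exp (t * ∑ i, boolSign (σ i) * a i) =
      ∏ i, ∑ b : Bool, Real.exp (t * (boolSign b * a i)) := by
    rw [Fintype.prod_sum]
    simp only [Finset.mul_sum, Real.exp_sum]
  have hfactor (i : Fin n) : ∑ b : Bool, Real.exp (t * (boolSign b * a i)) ≤
      2 * Real.exp (t ^ 2 / 2) := by
    have hcosh := Real.cosh_le_exp_half_sq (t * a i)
    have hsq : (t * a i) ^ 2 / 2 ≤ t ^ 2 / 2 := by
      have : a i ^ 2 ≤ 1 := (sq_le_one_iff_abs_le_one _).2 (ha i)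
      nlinarith [sq_nonneg t]
    have hexp := Real.exp_le_exp.2 hsq
    rw [Real.cosh_eq] at hcosh
    simp only [Fintype.sum_bool, boolSign, if_true, Bool.false_eq_true, if_false, one_mul,
      neg_one_mul, mul_neg]
    linarith
  rw [hprod]
  calc ∏ i, ∑ b : Bool, Real.exp (t * (boolSign b * a i))
      ≤ ∏ _i : Fin n, 2 * Real.exp (t ^ 2 / 2) :=
        Finset.prod_le_prod (fun i _ => by positivity) fun i _ => hfactor i
    _ = 2 ^ n * Real.exp (n * (t ^ 2 / 2)) := by
        simp [mul_pow, ← Real.exp_nat_mul]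

/-- A finite-class maximal inequality for Rademacher sums. -/
theorem sum_iSup_enorm_sign_sum_le {κ : Type*} [Nonempty κ] {n : ℕ} (a : κ → Fin n → ℝ)
    (A : Finset (Fin n → ℝ)) (hA : ∀ k, a k ∈ A)
    (hA1 : ∀ b ∈ A, ∀ i, |b i| ≤ 1) {N : ℝ} (hN : (A.card : ℝ) ≤ N) {t : ℝ} (ht : 0 < t) :
    ∑ σ : Fin n → Bool, ⨆ k, ‖∑ i, boolSign (σ i) * a k i‖ₑ ≤
      ENNReal.ofReal (2 ^ n * (Real.log (2 * N) / t + n * t / 2)) := by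
  classical
  set S : (Fin n → ℝ) → (Fin n → Bool) → ℝ := fun b σ => ∑ i, boolSign (σ i) * b i
  set L : ℝ := Real.log (2 * N) + n * (t ^ 2 / 2)
  set E : (Fin n → Bool) → ℝ := fun σ =>
    ∑ b ∈ A, (Real.exp (t * S b σ) + Real.exp (-t * S b σ))
  set U : (Fin n → Bool) → ℝ := fun σ => (L - 1 + E σ / Real.exp L) / t
  have hNpos : 0 < N := by
    obtain ⟨k⟩ := ‹Nonempty κ›
    have : 0 < A.card := Finset.card_pos.2 ⟨_, hA k⟩
    have : (0 : ℝ) < A.card := by exact_mod_cast this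
    linarith
  have hU (k : κ) (σ : Fin n → Bool) : |S (a k) σ| ≤ U σ := by
    have hterm : Real.exp (t * |S (a k) σ|) ≤ E σ := by
      refine le_trans ?_ (Finset.single_le_sum (f := fun b =>
        Real.exp (t * S b σ) + Real.exp (-t * S b σ)) (fun b _ => by positivity) (hA k))
      rcases abs_cases (S (a k) σ) with ⟨h, _⟩ | ⟨h, _⟩ <;> rw [h]
      · linarith [Real.exp_pos (-t * S (a k) σ)]
      · rw [show t * -S (a k) σ = -t * S (a k) σ by ring]
        linarith [Real.exp_pos (t * S (a k) σ)]
    rw [le_div_iff₀ ht]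
    have h1 := Real.add_one_le_exp (t * |S (a k) σ| - L)
    rw [Real.exp_sub] at h1
    have h2 : Real.exp (t * |S (a k) σ|) / Real.exp L ≤ E σ / Real.exp L := by gcongr
    linarith
  have hU0 (σ : Fin n → Bool) : 0 ≤ U σ :=
    (abs_nonneg _).trans (hU (Classical.arbitrary κ) σ)
  have hE : ∑ σ, E σ ≤ 2 ^ n * Real.exp L := by
    have hb (b : Fin n → ℝ) (hb : b ∈ A) :
        ∑ σ, (Real.exp (t * S b σ) + Real.exp (-t * S b σ)) ≤
          2 * (2 ^ n * Real.exp (n * (t ^ 2 / 2))) := by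
      have h1 := sum_exp_sign_sum_le b (hA1 b hb) t
      have h2 := sum_exp_sign_sum_le b (hA1 b hb) (-t)
      rw [neg_sq] at h2
      rw [Finset.sum_add_distrib]
      linarith
    calc ∑ σ, E σ
        = ∑ b ∈ A, ∑ σ, (Real.exp (t * S b σ) + Real.exp (-t * S b σ)) := Finset.sum_comm
      _ ≤ A.card • (2 * (2 ^ n * Real.exp (n * (t ^ 2 / 2)))) := Finset.sum_le_card_nsmul _ _ _ hb
      _ ≤ N * (2 * (2 ^ n * Real.exp (n * (t ^ 2 / 2)))) := by
          rw [nsmul_eq_mul]; gcongr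
      _ = 2 ^ n * Real.exp L := by
          rw [Real.exp_add, Real.exp_log (by positivity)]; ring
  calc ∑ σ : Fin n → Bool, ⨆ k, ‖S (a k) σ‖ₑ
      ≤ ∑ σ, ENNReal.ofReal (U σ) := by
        refine Finset.sum_le_sum fun σ _ => iSup_le fun k => ?_
        rw [Real.enorm_eq_ofReal_abs]
        exact ENNReal.ofReal_le_ofReal (hU k σ)
    _ = ENNReal.ofReal (∑ σ, U σ) := (ENNReal.ofReal_sum_of_nonneg fun σ _ => hU0 σ).symm
    _ ≤ ENNReal.ofReal (2 ^ n * (Real.log (2 * N) / t + n * t / 2)) := by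
        refine ENNReal.ofReal_le_ofReal ?_
        have hsum : ∑ σ, U σ = (2 ^ n * (L - 1) + (∑ σ, E σ) / Real.exp L) / t := by
          simp only [U, ← Finset.sum_div, Finset.sum_add_distrib, Finset.sum_const,
            Finset.card_univ, Fintype.card_fun, Fintype.card_bool, Fintype.card_fin, nsmul_eq_mul]
          push_cast
          rfl
        have hE' : (∑ σ, E σ) / Real.exp L ≤ 2 ^ n := by
          rwa [div_le_iff₀ (Real.exp_pos L)]
        rw [hsum, div_le_iff₀ ht]
        have : 2 ^ n * (Real.log (2 * N) / t + n * t / 2) * t = 2 ^ n * L := by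
          simp only [L]; field_simp
        rw [this]
        linarith

section Symmetrization

variable {Z κ : Type*} [MeasurableSpace Z] [Countable κ]

theorem lintegral_iSup_enorm_sum_sub_eq_sign (μ : Measure Z) [IsProbabilityMeasure μ]
    (g : κ → Z → ℝ) (hg : ∀ k, Measurable (g k)) {n : ℕ} (σ : Fin n → Bool) :
    ∫⁻ ω, ⨆ k, ‖∑ i, boolSign (σ i) * (g k (ω i).1 - g k (ω i).2)‖ₑ
        ∂(Measure.pi fun _ : Fin n => μ.prod μ) =
      ∫⁻ ω, ⨆ k, ‖∑ i, (g k (ω i).1 - g k (ω i).2)‖ₑ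
        ∂(Measure.pi fun _ : Fin n => μ.prod μ) := by
  have hswap (i : Fin n) : MeasurePreserving (if σ i then id else Prod.swap)
      (μ.prod μ) (μ.prod μ) := by
    split_ifs
    · exact MeasurePreserving.id _
    · exact Measure.measurePreserving_swap
  have hpi := measurePreserving_pi (fun _ : Fin n => μ.prod μ) (fun _ => μ.prod μ) hswap
  rw [← hpi.lintegral_comp (by fun_prop)]
  refine lintegral_congr fun ω => iSup_congr fun k => ?_
  congr 1
  refine Finset.sum_congr rfl fun i _ => ?_
  rcases Bool.eq_false_or_eq_true (σ i) with h | h <;> simp [boolSign, h]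

theorem lintegral_iSup_enorm_sub_expectation_le (μ : Measure Z) [IsProbabilityMeasure μ]
    (g : κ → Z → ℝ) (hg : ∀ k, Measurable (g k)) (hint : ∀ k, Integrable (g k) μ) (n : ℕ) :
    ∫⁻ s, ⨆ k, ‖∑ i, g k (s i) - n * ∫ z, g k z ∂μ‖ₑ ∂(Measure.pi fun _ : Fin n => μ) ≤
      ∫⁻ ω, ⨆ k, ‖∑ i, (g k (ω i).1 - g k (ω i).2)‖ₑ
        ∂(Measure.pi fun _ : Fin n => μ.prod μ) := by
  have hpres := measurePreserving_arrowProdEquivProdArrow Z Z (Fin n) (fun _ => μ) (fun _ => μ)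
  have hmeas : Measurable fun p : (Fin n → Z) × (Fin n → Z) =>
      ⨆ k, ‖∑ i, (g k (p.1 i) - g k (p.2 i))‖ₑ := by fun_prop
  have hrhs : ∫⁻ ω, ⨆ k, ‖∑ i, (g k (ω i).1 - g k (ω i).2)‖ₑ
        ∂(Measure.pi fun _ : Fin n => μ.prod μ) =
      ∫⁻ s, ∫⁻ s', ⨆ k, ‖∑ i, (g k (s i) - g k (s' i))‖ₑ
        ∂(Measure.pi fun _ : Fin n => μ) ∂(Measure.pi fun _ : Fin n => μ) := by
    rw [← lintegral_prod _ hmeas.aemeasurable, ← hpres.lintegral_comp hmeas]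
    rfl
  rw [hrhs]
  refine lintegral_mono fun s => iSup_le fun k => ?_
  have hcomp (i : Fin n) : Integrable (fun s' : Fin n → Z => g k (s' i))
      (Measure.pi fun _ : Fin n => μ) := integrable_comp_eval (hint k)
  have heq : ∑ i, g k (s i) - n * ∫ z, g k z ∂μ =
      ∫ s', ∑ i, (g k (s i) - g k (s' i)) ∂(Measure.pi fun _ : Fin n => μ) := by
    rw [integral_finsetSum (f := fun i (s' : Fin n → Z) => g k (s i) - g k (s' i)) _
      fun i _ => (integrable_const _).sub (hcomp i)]
    have (i : Fin n) : ∫ s', (g k (s i) - g k (s' i)) ∂(Measure.pi fun _ : Fin n => μ) =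
        g k (s i) - ∫ z, g k z ∂μ := by
      rw [integral_sub (integrable_const _) (hcomp i),
        integral_comp_eval (μ := fun _ : Fin n => μ) (hg k).aestronglyMeasurable]
      simp
    simp [this]
  rw [heq]
  refine (enorm_integral_le_lintegral_enorm _).trans (lintegral_mono fun s' => ?_)
  exact le_iSup (fun k => ‖∑ i, (g k (s i) - g k (s' i))‖ₑ) k

/-- Uniform deviation bound for a `[0, 1]`-valued class with at most `N` difference vectors on
every double sample. -/
theorem lintegral_iSup_deviation_le [Nonempty κ] (μ : Measure Z) [IsProbabilityMeasure μ]
    (g : κ → Z → ℝ) (hg : ∀ k, Measurable (g k)) (hg01 : ∀ k z, g k z ∈ Set.Icc (0 : ℝ) 1)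
    {n : ℕ} {N : ℝ}
    (hN : ∀ ω : Fin n → Z × Z, ∃ A : Finset (Fin n → ℝ), (A.card : ℝ) ≤ N ∧
      ∀ k, (fun i => g k (ω i).1 - g k (ω i).2) ∈ A) {t : ℝ} (ht : 0 < t) :
    ∫⁻ s, ⨆ k, ‖∑ i, g k (s i) - n * ∫ z, g k z ∂μ‖ₑ ∂(Measure.pi fun _ : Fin n => μ) ≤
      ENNReal.ofReal (Real.log (2 * N) / t + n * t / 2) := by
  classical
  have hint (k : κ) : Integrable (g k) μ :=
    .of_bound (hg k).aestronglyMeasurable 1 <| ae_of_all _ fun z => by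
      rw [Real.norm_of_nonneg (hg01 k z).1]; exact (hg01 k z).2
  refine (lintegral_iSup_enorm_sub_expectation_le μ g hg hint n).trans ?_
  set I := ∫⁻ ω, ⨆ k, ‖∑ i, (g k (ω i).1 - g k (ω i).2)‖ₑ
        ∂(Measure.pi fun _ : Fin n => μ.prod μ)
  have hdiff (k : κ) (z w : Z) : |g k z - g k w| ≤ 1 := by
    have := hg01 k z; have := hg01 k w
    simp only [Set.mem_Icc] at *
    rw [abs_le]; constructor <;> linarith
  have hpoint (ω : Fin n → Z × Z) :
      ∑ σ : Fin n → Bool, ⨆ k, ‖∑ i, boolSign (σ i) * (g k (ω i).1 - g k (ω i).2)‖ₑ ≤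
        ENNReal.ofReal (2 ^ n * (Real.log (2 * N) / t + n * t / 2)) := by
    obtain ⟨A, hAN, hA⟩ := hN ω
    refine sum_iSup_enorm_sign_sum_le (fun k i => g k (ω i).1 - g k (ω i).2)
      (A.filter fun b => ∀ i, |b i| ≤ 1)
      (fun k => Finset.mem_filter.2 ⟨hA k, fun i => hdiff k _ _⟩)
      (fun b hb => (Finset.mem_filter.1 hb).2) (le_trans ?_ hAN) ht
    exact_mod_cast Finset.card_filter_le _ _
  have htotal : (2 : ℝ≥0∞) ^ n * I ≤
      ENNReal.ofReal (2 ^ n * (Real.log (2 * N) / t + n * t / 2)) := by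
    calc (2 : ℝ≥0∞) ^ n * I
        = ∑ σ : Fin n → Bool, ∫⁻ ω, ⨆ k,
            ‖∑ i, boolSign (σ i) * (g k (ω i).1 - g k (ω i).2)‖ₑ
            ∂(Measure.pi fun _ : Fin n => μ.prod μ) := by
          simp [lintegral_iSup_enorm_sum_sub_eq_sign μ g hg, I]
      _ = ∫⁻ ω, ∑ σ : Fin n → Bool, ⨆ k,
            ‖∑ i, boolSign (σ i) * (g k (ω i).1 - g k (ω i).2)‖ₑ
            ∂(Measure.pi fun _ : Fin n => μ.prod μ) :=
          (lintegral_finsetSum _ fun σ _ => by fun_prop).symm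
      _ ≤ ∫⁻ _, ENNReal.ofReal (2 ^ n * (Real.log (2 * N) / t + n * t / 2))
            ∂(Measure.pi fun _ : Fin n => μ.prod μ) := lintegral_mono hpoint
      _ = _ := by simp
  rw [ENNReal.ofReal_mul (by positivity), ENNReal.ofReal_pow (by norm_num),
    ENNReal.ofReal_ofNat] at htotal
  exact (ENNReal.mul_le_mul_iff_right (by positivity) (by finiteness)).1 htotal

end Symmetrization

theorem sum_choose_le_succ_pow (m d : ℕ) : ∑ k ∈ Finset.Iic d, m.choose k ≤ (m + 1) ^ d := by
  induction d with
  | zero => simp [show Finset.Iic (0 : ℕ) = {0} from rfl]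
  | succ d ih =>
    have hsplit : Finset.Iic (d + 1) = insert (d + 1) (Finset.Iic d) := by ext; simp; omega
    rw [hsplit, Finset.sum_insert (by simp)]
    have h1 : m.choose (d + 1) ≤ m * (m + 1) ^ d := by
      calc m.choose (d + 1) ≤ m ^ (d + 1) := Nat.choose_le_pow _ _
        _ = m * m ^ d := by ring
        _ ≤ m * (m + 1) ^ d := by gcongr; omega
    rw [pow_succ]
    linarith

/-- Sauer–Shelah bound for the traces of a class on a finite family of points. -/
theorem exists_trace_finset {X α : Type*} [Fintype α] [DecidableEq α] (F : Set (X → Bool)) {d : ℕ}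
    (hd : ∀ m, ShattersCard F m → m ≤ d) (x : α → X) :
    ∃ T : Finset (Finset α), T.card ≤ (Fintype.card α + 1) ^ d ∧
      ∀ f ∈ F, (Finset.univ.filter fun j => f (x j) = true) ∈ T := by
  classical
  set T : Finset (Finset α) := Finset.univ.filter fun t =>
    ∃ f ∈ F, (Finset.univ.filter fun j => f (x j) = true) = t
  refine ⟨T, ?_, fun f hf => Finset.mem_filter.2 ⟨Finset.mem_univ _, f, hf, rfl⟩⟩
  have hdim : T.vcDim ≤ d := by
    refine Finset.sup_le fun s hs => hd _ ⟨fun i => x (s.equivFin.symm i), fun v => ?_⟩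
    rw [Finset.mem_shatterer] at hs
    obtain ⟨u, hu, hsu⟩ := hs (t := s.filter fun j => ∃ h : j ∈ s, v (s.equivFin ⟨j, h⟩) = true)
      (Finset.filter_subset _ _)
    obtain ⟨f, hf, rfl⟩ := (Finset.mem_filter.1 hu).2
    refine ⟨f, hf, fun i => ?_⟩
    have hmem := (s.equivFin.symm i).2
    have h := Finset.ext_iff.1 hsu (s.equivFin.symm i)
    simp only [Finset.mem_inter, Finset.mem_filter, Finset.mem_univ, true_and, hmem,
      exists_true_left, Subtype.coe_eta, Equiv.apply_symm_apply] at h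
    exact Bool.eq_iff_iff.2 h
  calc T.card ≤ T.shatterer.card := T.card_le_card_shatterer
    _ ≤ ∑ k ∈ Finset.Iic T.vcDim, (Fintype.card α).choose k := T.card_shatterer_le_sum_vcDim
    _ ≤ ∑ k ∈ Finset.Iic d, (Fintype.card α).choose k :=
        Finset.sum_le_sum_of_subset (Finset.Iic_subset_Iic.2 hdim)
    _ ≤ (Fintype.card α + 1) ^ d := sum_choose_le_succ_pow _ _

/-- The 0-1 loss of a classifier on a labeled point. -/
noncomputable def zeroOneLoss {X : Type*} (f : X → Bool) (z : X × Bool) : ℝ :=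
  if f z.1 ≠ z.2 then 1 else 0

section ZeroOneLoss

variable {X : Type*}

theorem zeroOneLoss_mem_Icc (f : X → Bool) (z : X × Bool) :
    zeroOneLoss f z ∈ Set.Icc (0 : ℝ) 1 := by
  unfold zeroOneLoss; split_ifs <;> simp

theorem sum_zeroOneLoss_eq {n : ℕ} (hn : n ≠ 0) (f : X → Bool) (s : Fin n → X × Bool) :
    ∑ i, zeroOneLoss f (s i) = n * empRisk f s := by
  have : (n : ℝ) ≠ 0 := by exact_mod_cast hn
  unfold empRisk zeroOneLoss
  rw [mul_div_cancel₀ _ this, Finset.sum_boole]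

theorem exists_loss_difference_finset {F : Set (X → Bool)} {d : ℕ}
    (hd : ∀ m, ShattersCard F m → m ≤ d) {n : ℕ} (ω : Fin n → (X × Bool) × (X × Bool)) :
    ∃ A : Finset (Fin n → ℝ), (A.card : ℝ) ≤ (2 * n + 1 : ℝ) ^ d ∧
      ∀ f : F, (fun i => zeroOneLoss (f : X → Bool) (ω i).1 -
        zeroOneLoss (f : X → Bool) (ω i).2) ∈ A := by
  classical
  obtain ⟨T, hT, hFT⟩ := exists_trace_finset F hd
    (Sum.elim (fun i => (ω i).1.1) fun i => (ω i).2.1)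
  let loss (t : Finset (Fin n ⊕ Fin n)) (j : Fin n ⊕ Fin n) (y : Bool) : ℝ :=
    if decide (j ∈ t) ≠ y then 1 else 0
  refine ⟨T.image fun t i => loss t (.inl i) (ω i).1.2 - loss t (.inr i) (ω i).2.2, ?_,
    fun f => Finset.mem_image.2 ⟨_, hFT f f.2, ?_⟩⟩
  · have hcard := (Finset.card_image_le (s := T) (f := fun t (i : Fin n) =>
      loss t (.inl i) (ω i).1.2 - loss t (.inr i) (ω i).2.2)).trans hT
    rw [Fintype.card_sum, Fintype.card_fin, ← two_mul] at hcard
    exact_mod_cast hcard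
  · funext i
    simp [loss, zeroOneLoss]

variable [MeasurableSpace X]

theorem measurableSet_misclassified {f : X → Bool} (hf : Measurable f) :
    MeasurableSet {p : X × Bool | f p.1 ≠ p.2} :=
  (measurableSet_eq_fun (hf.comp measurable_fst) measurable_snd).compl

theorem measurable_zeroOneLoss {f : X → Bool} (hf : Measurable f) :
    Measurable (zeroOneLoss f) :=
  Measurable.ite (measurableSet_misclassified hf) measurable_const measurable_const

theorem integral_zeroOneLoss {f : X → Bool} (hf : Measurable f) (P : Measure (X × Bool)) :
    ∫ z, zeroOneLoss f z ∂P = risk P f := by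
  classical
  rw [risk, ← measureReal_def, ← integral_indicator_one (measurableSet_misclassified hf)]
  refine integral_congr_ae (ae_of_all _ fun z => ?_)
  simp [zeroOneLoss, Set.indicator_apply]

/-- Vapnik–Chervonenkis uniform convergence for the empirical risk over a countable class. -/
theorem measure_uniform_deviation_le {F : Set (X → Bool)} (hFc : F.Countable)
    (hF : ∀ f ∈ F, Measurable f) (hFne : F.Nonempty) {d : ℕ}
    (hd : ∀ m, ShattersCard F m → m ≤ d) (P : Measure (X × Bool)) [IsProbabilityMeasure P]
    {n : ℕ} (hn : n ≠ 0) {δ t : ℝ} (hδ : 0 < δ) (ht : 0 < t) :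
    (Measure.pi fun _ : Fin n => P) {s | ∃ f ∈ F, δ ≤ |empRisk f s - risk P f|} ≤
      ENNReal.ofReal ((Real.log (2 * (2 * n + 1) ^ d) / n / t + t / 2) / δ) := by
  have := hFc.to_subtype
  have := hFne.to_subtype
  have hn' : (0 : ℝ) < n := by exact_mod_cast Nat.pos_of_ne_zero hn
  have hloss (f : F) : Measurable (zeroOneLoss (f : X → Bool)) :=
    measurable_zeroOneLoss (hF f f.2)
  have hbound := lintegral_iSup_deviation_le P (fun f : F => zeroOneLoss (f : X → Bool)) hloss
    (fun f z => zeroOneLoss_mem_Icc _ z) (exists_loss_difference_finset hd (n := n)) ht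
  have hdev (f : F) (s : Fin n → X × Bool) :
      ‖∑ i, zeroOneLoss (f : X → Bool) (s i) - n * ∫ z, zeroOneLoss (f : X → Bool) z ∂P‖ₑ =
        ENNReal.ofReal (n * |empRisk (f : X → Bool) s - risk P f|) := by
    rw [sum_zeroOneLoss_eq hn, integral_zeroOneLoss (hF f f.2), ← mul_sub,
      Real.enorm_eq_ofReal_abs, abs_mul, Nat.abs_cast]
  have hmeas : Measurable fun s : Fin n → X × Bool => ⨆ f : F,
      ‖∑ i, zeroOneLoss (f : X → Bool) (s i) - n * ∫ z, zeroOneLoss (f : X → Bool) z ∂P‖ₑ := by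
    fun_prop
  have hpos : 0 < ENNReal.ofReal (n * δ) := ENNReal.ofReal_pos.2 (by positivity)
  calc (Measure.pi fun _ : Fin n => P) {s | ∃ f ∈ F, δ ≤ |empRisk f s - risk P f|}
      ≤ (Measure.pi fun _ : Fin n => P) {s | ENNReal.ofReal (n * δ) ≤ ⨆ f : F,
          ‖∑ i, zeroOneLoss (f : X → Bool) (s i) -
            n * ∫ z, zeroOneLoss (f : X → Bool) z ∂P‖ₑ} := by
        refine measure_mono ?_
        rintro s ⟨f, hf, hfs⟩
        rw [Set.mem_ofPred_eq]
        refine le_iSup_of_le (⟨f, hf⟩ : F) ?_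
        rw [hdev]
        exact ENNReal.ofReal_le_ofReal (by gcongr)
    _ ≤ _ := meas_ge_le_lintegral_div hmeas.aemeasurable hpos.ne' ENNReal.ofReal_ne_top
    _ ≤ ENNReal.ofReal (Real.log (2 * (2 * n + 1) ^ d) / t + n * t / 2) /
          ENNReal.ofReal (n * δ) := by gcongr
    _ = ENNReal.ofReal ((Real.log (2 * (2 * n + 1) ^ d) / n / t + t / 2) / δ) := by
        rw [← ENNReal.ofReal_div_of_pos (by positivity)]
        congr 1
        field_simp

end ZeroOneLoss

theorem tendsto_log_growth_div {d : ℕ → ℕ}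
    (hd : Tendsto (fun n : ℕ => (d n : ℝ) * Real.log n / n) atTop (nhds 0)) :
    Tendsto (fun n : ℕ => Real.log (2 * (2 * n + 1 : ℝ) ^ d n) / n) atTop (nhds 0) := by
  have hlim : Tendsto (fun n : ℕ => Real.log 2 / n + 3 * ((d n : ℝ) * Real.log n / n))
      atTop (nhds 0) := by
    simpa using (tendsto_const_div_atTop_nhds_zero_nat (Real.log 2)).add (hd.const_mul 3)
  refine squeeze_zero' (Eventually.of_forall fun n => ?_) ?_ hlim
  · refine div_nonneg (Real.log_nonneg ?_) n.cast_nonneg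
    have : (1 : ℝ) ≤ (2 * n + 1) ^ d n := one_le_pow₀ (by linarith [n.cast_nonneg (α := ℝ)])
    linarith
  · filter_upwards [eventually_ge_atTop 3] with n hn
    have hn' : (3 : ℝ) ≤ n := by exact_mod_cast hn
    have hlog : Real.log (2 * n + 1) ≤ 3 * Real.log n := by
      rw [← Nat.cast_ofNat (n := 3), ← Real.log_pow]
      refine Real.log_le_log (by positivity) ?_
      nlinarith [mul_nonneg (by linarith : (0 : ℝ) ≤ n - 3) (by positivity : (0 : ℝ) ≤ (n : ℝ) ^ 2),
        mul_nonneg (by linarith : (0 : ℝ) ≤ n - 3) (by positivity : (0 : ℝ) ≤ (n : ℝ))]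
    rw [Real.log_mul (by norm_num) (by positivity), Real.log_pow, ← mul_div_assoc, ← add_div]
    refine div_le_div_of_nonneg_right ?_ n.cast_nonneg
    nlinarith [mul_le_mul_of_nonneg_left hlog (d n).cast_nonneg (α := ℝ)]

/-- **Bayes consistency via nested function spaces.** Let `F_1 ⊆ F_2 ⊆ …` be an increasing
sequence of countable classes of classifiers and `f_n` an empirical risk minimizer over `F_n`
on the i.i.d. `n`-sample. If (1) each `F_n` has finite VC dimension `d_n` with
`d_n · log n / n → 0`, and (2) for every distribution `P`,
`inf_{f ∈ F_n} R(f) → R*` (the Bayes risk of `P`), then `(f_n)` is universally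
Bayes-consistent: for every `P` and every `ε > 0`, `Pr(R(f_n) − R* > ε) → 0`. -/
theorem nested_classes_bayes_consistent {X : Type*} [MeasurableSpace X]
    (F : ℕ → Set (X → Bool)) (hmono : ∀ n : ℕ, F n ⊆ F (n + 1))
    (hFc : ∀ n, (F n).Countable) (hFmeas : ∀ n, ∀ f ∈ F n, Measurable f)
    (fn : ∀ n : ℕ, (Fin n → X × Bool) → (X → Bool))
    (hfn : ∀ n s, fn n s ∈ F n)
    (hfnerm : ∀ n s, ∀ f ∈ F n, empRisk (fn n s) s ≤ empRisk f s)
    (d : ℕ → ℕ) (hd : ∀ n, IsGreatest {m : ℕ | ShattersCard (F n) m} (d n))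
    (hdrate : Tendsto (fun n : ℕ => (d n : ℝ) * Real.log n / n) atTop (nhds 0))
    (happrox : ∀ (P : Measure (X × Bool)), IsProbabilityMeasure P →
      Tendsto (fun n : ℕ => ⨅ f : F n, risk P (f : X → Bool)) atTop (nhds (bayesRisk P))) :
    ∀ (P : Measure (X × Bool)), IsProbabilityMeasure P →
      ∀ ε > (0 : ℝ),
        Tendsto (fun n : ℕ =>
            ((Measure.pi fun _ : Fin n => P)
              {s | ε < risk P (fn n s) - bayesRisk P}).toReal)
          atTop (nhds 0) := by
  intro P hP ε hε
  have hgrowth := tendsto_log_growth_div hdrate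
  rw [Metric.tendsto_nhds]
  intro η hη
  set δ := ε / 8
  have hδ : 0 < δ := by positivity
  have hsmall := hgrowth.eventually_lt_const (show 0 < δ * η * (δ * η) / 2 by positivity)
  have hinf := (happrox P hP).eventually_lt_const
    (show bayesRisk P < bayesRisk P + ε / 2 by linarith)
  filter_upwards [hsmall, hinf, eventually_ne_atTop 0] with n hn hninf hn0
  have hFne : (F n).Nonempty := by
    obtain ⟨z⟩ := nonempty_of_isProbabilityMeasure P
    exact ⟨_, hfn n fun _ => z⟩
  have := hFne.to_subtype
  obtain ⟨⟨f, hf⟩, hfrisk⟩ := exists_lt_of_ciInf_lt hninf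
  have hsub : {s | ε < risk P (fn n s) - bayesRisk P} ⊆
      {s : Fin n → X × Bool | ∃ f ∈ F n, δ ≤ |empRisk f s - risk P f|} := by
    intro s hs
    by_contra! hcon
    simp only [Set.mem_ofPred_eq, not_exists, not_and, not_le] at hs hcon
    have h1 := abs_lt.1 (hcon _ (hfn n s))
    have h2 := abs_lt.1 (hcon f hf)
    have h3 := hfnerm n s f hf
    simp only [δ] at h1 h2
    linarith [h1.1, h2.2]
  have hmeasure := (measure_mono hsub).trans (measure_uniform_deviation_le (hFc n) (hFmeas n)
    hFne (fun m hm => (hd n).2 hm) P hn0 hδ (t := δ * η) (by positivity))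
  rw [Real.dist_eq, sub_zero, abs_of_nonneg ENNReal.toReal_nonneg]
  have hη' : Real.log (2 * (2 * n + 1 : ℝ) ^ d n) / n / (δ * η) < δ * η / 2 := by
    rw [div_lt_iff₀ (by positivity)]
    linarith
  have hb : (Real.log (2 * (2 * n + 1 : ℝ) ^ d n) / n / (δ * η) + δ * η / 2) / δ < η := by
    rw [div_lt_iff₀ hδ]
    linarith
  rw [← ENNReal.ofReal_lt_ofReal_iff hη] at hb
  exact ENNReal.toReal_lt_of_lt_ofReal (hmeasure.trans_lt hb)
end
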